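/- (Theorem 1(iv)) Let λ = 1/π, let g ∈ E, and let (φ₁, φ₂) be an admissible weight pair. Then f ∈ E satisfies the Stieltjes equation f(x) = g(x) + λ ∫₀^∞ f(y)/(x+y) dy for almost every x > 0 if and only if there exist constants A, B ∈ ℂ such that f(x) = g(x) + (2/π²)·x·∫₀^∞ (φ₁(y)·(y/x) + φ₂(y)·(x/y))·(1/(x² − y²))·(y/x)^{1/2}·ln(y/x)·g(y) dy + x^{-1/2}·(A + B·ln(x)) for almost every x > 0, where the integral is absolutely convergent for every x > 0. -/

import Mathlib

open MeasureTheory Set Asymptotics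

noncomputable section

/-- `r₁(x;α)` from Dixon's resolvent kernels. -/
def r1 (α : ℂ) (x : ℝ) : ℂ :=
  if α = -(1/2 : ℂ) then
    -(2 / (Real.pi : ℂ)) * ((x : ℂ) ^ ((1 : ℂ)/2) * (Real.log x : ℂ)) / (1 - (x : ℂ) ^ 2)
  else
    (1 / Complex.cos ((Real.pi : ℂ) * α)) *
      (((x : ℂ) ^ (-α) - (x : ℂ) ^ (α + 1)) / (1 - (x : ℂ) ^ 2))

def r2 (α : ℂ) (x : ℝ) : ℂ := -(1 / (x : ℂ)) * r1 (-α) x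

def r3 (α : ℂ) (x : ℝ) : ℂ := (x : ℂ) ^ 2 * r2 α x

def R1 (α : ℂ) (x y : ℝ) : ℂ := (1 / (y : ℂ)) * r1 α (x / y)
def R2 (α : ℂ) (x y : ℝ) : ℂ := (1 / (y : ℂ)) * r2 α (x / y)
def R3 (α : ℂ) (x y : ℝ) : ℂ := (1 / (y : ℂ)) * r3 α (x / y)

/-- membership in `E`: integrable on `(0,∞)` with weight `1/(1+x)`. -/
def MemE (f : ℝ → ℂ) : Prop :=
  IntegrableOn (fun x : ℝ => f x / (1 + (x : ℂ))) (Ioi 0)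

/-- membership in `E_k`: integrable on `(0,∞)` with weight `x^{k-1}`. -/
def MemEk (k : ℝ) (f : ℝ → ℂ) : Prop :=
  IntegrableOn (fun x : ℝ => (x ^ (k - 1) : ℝ) • f x) (Ioi 0)

/-- membership in `B_{ε,η}`. -/
def MemB (ε η : ℝ) (f : ℝ → ℂ) : Prop :=
  ContinuousOn f (Ioi 0) ∧
  ∃ M : ℝ, (∀ x : ℝ, 1 < x → x ^ ε * ‖f x‖ ≤ M) ∧ (∀ x : ℝ, 0 < x → x < 1 → x ^ η * ‖f x‖ ≤ M)

/-- the norm of `B_{ε,η}`. -/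
def Bnorm (ε η : ℝ) (f : ℝ → ℂ) : ℝ :=
  sSup ((fun x : ℝ => x ^ ε * ‖f x‖) '' Ioi 1) + sSup ((fun x : ℝ => x ^ η * ‖f x‖) '' Ioo 0 1)

/-- admissible weight pair `(φ₁,φ₂)`. -/
def AdmissiblePair (φ₁ φ₂ : ℝ → ℝ) : Prop :=
  ContinuousOn φ₁ (Ioi 0) ∧ ContinuousOn φ₂ (Ioi 0) ∧
  (∀ y : ℝ, 0 < y → (φ₁ y ∈ Ioo (0:ℝ) 1 ∧ φ₂ y ∈ Ioo (0:ℝ) 1 ∧ φ₁ y + φ₂ y = 1)) ∧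
  φ₁ =O[Filter.atTop] (fun y : ℝ => 1 / y) ∧
  (fun y : ℝ => φ₁ y - 1) =O[nhdsWithin 0 (Ioi 0)] (fun y : ℝ => y)

/-- the combined kernel `R₂₃`. -/
def R23 (φ₁ φ₂ : ℝ → ℝ) (α : ℂ) (x y : ℝ) : ℂ :=
  (φ₁ y : ℂ) * R2 α x y + (φ₂ y : ℂ) * R3 α x y

/-- Lebesgue measure on `(0,∞)`. -/
abbrev posVolume : Measure ℝ := volume.restrict (Ioi 0)

theorem integral_kernel_swap {W : ℝ → ℝ → ℝ} (hm : Measurable (Function.uncurry W))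
    (h0 : ∀ z y, 0 < z → 0 < y → 0 ≤ W z y) {J : ℝ → ℝ} {h : ℝ → ℂ}
    (hh : AEStronglyMeasurable h posVolume)
    (hW : ∀ᵐ y ∂posVolume, Integrable (fun z => W z y) posVolume ∧
      ∫ z, W z y ∂posVolume = J y)
    (hJ : Integrable (fun y => (J y : ℂ) * h y) posVolume) :
    Integrable (fun z => ∫ y, (W z y : ℂ) * h y ∂posVolume) posVolume ∧
      ∫ z, ∫ y, (W z y : ℂ) * h y ∂posVolume ∂posVolume =
        ∫ y, (J y : ℂ) * h y ∂posVolume := by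
  have hK : Integrable (Function.uncurry fun z y => (W z y : ℂ) * h y)
      (posVolume.prod posVolume) := by
    have hmeas : AEStronglyMeasurable (Function.uncurry fun z y => (W z y : ℂ) * h y)
        (posVolume.prod posVolume) := by
      have h1 : AEStronglyMeasurable (fun p : ℝ × ℝ => (W p.1 p.2 : ℂ))
          (posVolume.prod posVolume) :=
        (Complex.measurable_ofReal.comp hm).aestronglyMeasurable
      exact h1.mul hh.comp_snd
    refine (integrable_prod_iff' hmeas).2 ⟨?_, ?_⟩
    · filter_upwards [hW] with y hy
      have h1 : Integrable (fun z => (W z y : ℂ)) posVolume := hy.1.ofReal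
      exact h1.mul_const (h y)
    · refine hJ.norm.congr ?_
      filter_upwards [hW, ae_restrict_mem measurableSet_Ioi] with y hy hy0
      have : ∫ z, ‖(W z y : ℂ) * h y‖ ∂posVolume = ∫ z, W z y * ‖h y‖ ∂posVolume := by
        refine integral_congr_ae ?_
        filter_upwards [ae_restrict_mem measurableSet_Ioi] with z hz
        simp [abs_of_nonneg (h0 z y hz hy0)]
      have hJ0 : 0 ≤ J y := by
        rw [← hy.2]
        refine integral_nonneg_of_ae ?_
        filter_upwards [ae_restrict_mem measurableSet_Ioi] with z hz
        exact h0 z y hz hy0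
      simp only [Function.uncurry]
      rw [this, integral_mul_const, hy.2]
      simp [abs_of_nonneg hJ0]
  refine ⟨Integrable.integral_prod_left hK, ?_⟩
  rw [integral_integral_swap hK]
  refine integral_congr_ae ?_
  filter_upwards [hW] with y hy
  rw [integral_mul_const, integral_complex_ofReal, hy.2]

/-- `∫₀^∞ z^{-1/2} / (x + z) dz = π x^{-1/2}`. -/
theorem integral_inv_sqrt_div_add {x : ℝ} (hx : 0 < x) :
    Integrable (fun z => (√z)⁻¹ / (x + z)) posVolume ∧
      ∫ z, (√z)⁻¹ / (x + z) ∂posVolume = Real.pi * (√x)⁻¹ := by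
  have hsx := Real.sqrt_pos.2 hx
  have hd : ∀ z ∈ Ioi (0 : ℝ), HasDerivAt (fun z => 2 * (√x)⁻¹ * Real.arctan (√z * (√x)⁻¹))
      ((√z)⁻¹ / (x + z)) z := by
    intro z hz
    have hz : 0 < z := hz
    have hsz := Real.sqrt_pos.2 hz
    have := (((Real.hasDerivAt_sqrt hz.ne').mul_const (√x)⁻¹).arctan).const_mul (2 * (√x)⁻¹)
    refine this.congr_deriv ?_
    have h1 := Real.sq_sqrt hx.le
    have h2 := Real.sq_sqrt hz.le
    generalize √x = a at *
    generalize √z = b at *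
    subst h1 h2
    field_simp
  have hc : ContinuousWithinAt (fun z => 2 * (√x)⁻¹ * Real.arctan (√z * (√x)⁻¹)) (Ici 0) 0 := by
    fun_prop
  have hp : ∀ z ∈ Ioi (0 : ℝ), 0 ≤ (√z)⁻¹ / (x + z) := by
    intro z hz
    have hz : 0 < z := hz
    positivity
  have ht : Filter.Tendsto (fun z => 2 * (√x)⁻¹ * Real.arctan (√z * (√x)⁻¹)) Filter.atTop
      (nhds (2 * (√x)⁻¹ * (Real.pi / 2))) := by
    refine Filter.Tendsto.const_mul _ ((Real.tendsto_arctan_atTop.mono_right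
      nhdsWithin_le_nhds).comp ?_)
    exact Real.tendsto_sqrt_atTop.atTop_mul_const (by positivity)
  refine ⟨integrableOn_Ioi_deriv_of_nonneg hc hd hp ht, ?_⟩
  rw [integral_Ioi_of_hasDerivAt_of_nonneg hc hd hp ht]
  simp
  ring

/-- `∫₀^∞ du / ((z + u)(y + u)) = (log z - log y) / (z - y)`. -/
theorem integral_inv_add_mul_add {z y : ℝ} (hz : 0 < z) (hy : 0 < y) (hzy : z ≠ y) :
    ∫ u, 1 / ((z + u) * (y + u)) ∂posVolume = (Real.log z - Real.log y) / (z - y) := by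
  have hzy' : z - y ≠ 0 := sub_ne_zero.2 hzy
  have hd : ∀ u ∈ Ioi (0 : ℝ),
      HasDerivAt (fun u => (Real.log ((y + u) / (z + u))) / (z - y))
      (1 / ((z + u) * (y + u))) u := by
    intro u hu
    have hu : 0 < u := hu
    have h1 : HasDerivAt (fun u => (y + u) / (z + u)) _ u :=
      ((hasDerivAt_id u).const_add y).div ((hasDerivAt_id u).const_add z)
        (by positivity)
    have := (h1.log (by positivity)).div_const (z - y)
    refine this.congr_deriv ?_
    simp only [id]
    field_simp
    ring
  have hc : ContinuousWithinAt (fun u => (Real.log ((y + u) / (z + u))) / (z - y)) (Ici 0) 0 := by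
    refine ContinuousAt.continuousWithinAt ?_
    refine ContinuousAt.div_const (ContinuousAt.log
      (ContinuousAt.div (by fun_prop) (by fun_prop) ?_) ?_) _
    · simp [hz.ne']
    · simp [hz.ne', hy.ne']
  have hp : ∀ u ∈ Ioi (0 : ℝ), 0 ≤ 1 / ((z + u) * (y + u)) := by
    intro u hu
    have hu : 0 < u := hu
    positivity
  have ht : Filter.Tendsto (fun u => (Real.log ((y + u) / (z + u))) / (z - y)) Filter.atTop
      (nhds (Real.log 1 / (z - y))) := by
    refine Filter.Tendsto.div_const (Filter.Tendsto.log ?_ one_ne_zero) _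
    have h3 : Filter.Tendsto (fun u : ℝ => 1 + (y - z) / (z + u)) Filter.atTop (nhds (1 + 0)) :=
      tendsto_const_nhds.add (Filter.Tendsto.div_atTop tendsto_const_nhds
        (Filter.tendsto_atTop_add_const_left _ _ Filter.tendsto_id))
    rw [add_zero] at h3
    refine h3.congr' ?_
    filter_upwards [Filter.eventually_gt_atTop 0] with u hu
    have : z + u ≠ 0 := by positivity
    field_simp
    ring
  rw [integral_Ioi_of_hasDerivAt_of_nonneg hc hd hp ht]
  simp only [add_zero, Real.log_one, Real.log_div hy.ne' hz.ne']
  ring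

/-- `∫₀^∞ z^{-1/2} log (z / y) / (z - y) dz = π² y^{-1/2}`. -/
theorem integral_inv_sqrt_log_div_sub {y : ℝ} (hy : 0 < y) :
    Integrable (fun z => (√z)⁻¹ * ((Real.log z - Real.log y) / (z - y))) posVolume ∧
      ∫ z, (√z)⁻¹ * ((Real.log z - Real.log y) / (z - y)) ∂posVolume =
        Real.pi ^ 2 * (√y)⁻¹ := by
  have key := integral_kernel_swap (W := fun z u => (√z)⁻¹ / (u + z))
    (J := fun u => Real.pi * (√u)⁻¹) (h := fun u => ((1 / (y + u) : ℝ) : ℂ))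
    (by unfold Function.uncurry; fun_prop) (by intro z u hz hu; positivity)
    (Measurable.aestronglyMeasurable (by fun_prop))
    (by
      filter_upwards [ae_restrict_mem measurableSet_Ioi] with u hu
      exact integral_inv_sqrt_div_add hu)
    (by
      refine (((integral_inv_sqrt_div_add hy).1.const_mul Real.pi).ofReal (𝕜 := ℂ)).congr
        (Filter.Eventually.of_forall fun u => ?_)
      simp
      ring)
  have hne : ∀ᵐ z ∂posVolume, z ≠ y := ae_restrict_of_ae (Measure.ae_ne volume y)
  have hin : (fun z : ℝ => ∫ u, (((√z)⁻¹ / (u + z) : ℝ) : ℂ) * ((1 / (y + u) : ℝ) : ℂ) ∂posVolume)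
      =ᵐ[posVolume] fun z =>
        (((√z)⁻¹ * ((Real.log z - Real.log y) / (z - y)) : ℝ) : ℂ) := by
    filter_upwards [ae_restrict_mem measurableSet_Ioi, hne] with z hz hzy
    rw [← integral_inv_add_mul_add hz hy hzy, ← integral_const_mul, ← integral_complex_ofReal]
    congr 1
    ext u
    rw [← Complex.ofReal_mul]
    congr 1
    rw [div_mul_div_comm, mul_one_div, mul_one, add_comm u]
  obtain ⟨k1, k2⟩ := key
  have k1' := (k1.congr hin).re
  refine ⟨k1', ?_⟩
  rw [integral_congr_ae hin, integral_complex_ofReal] at k2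
  have h3 : ∫ u, ((Real.pi * (√u)⁻¹ : ℝ) : ℂ) * ((1 / (y + u) : ℝ) : ℂ) ∂posVolume =
      ((Real.pi ^ 2 * (√y)⁻¹ : ℝ) : ℂ) := by
    rw [pow_two, mul_assoc, ← (integral_inv_sqrt_div_add hy).2, ← integral_const_mul,
      ← integral_complex_ofReal]
    congr 1
    ext u
    push_cast
    ring
  exact_mod_cast k2.trans h3

/-- `∫₀^∞ z^{-1/2} log (z / x) / (x + z) dz = 0`. -/
theorem integral_inv_sqrt_log_div_add_self {x : ℝ} (hx : 0 < x) :
    Integrable (fun z => (√z)⁻¹ * ((Real.log z - Real.log x) / (x + z))) posVolume ∧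
      ∫ z, (√z)⁻¹ * ((Real.log z - Real.log x) / (x + z)) ∂posVolume = 0 := by
  constructor
  · refine (integral_inv_sqrt_log_div_sub hx).1.mono
      (Measurable.aestronglyMeasurable (by fun_prop)) ?_
    filter_upwards [ae_restrict_mem measurableSet_Ioi,
      ae_restrict_of_ae (Measure.ae_ne volume x)] with z hz hzx
    have hz : 0 < z := hz
    rw [norm_mul, norm_mul, norm_div, norm_div]
    have h1 : 0 < ‖z - x‖ := norm_pos_iff.2 (sub_ne_zero.2 hzx)
    have h2 : ‖z - x‖ ≤ ‖x + z‖ := by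
      rw [Real.norm_eq_abs, Real.norm_eq_abs, abs_of_pos (show 0 < x + z by positivity), abs_le]
      constructor <;> linarith
    gcongr
  · set F : ℝ → ℝ := fun z => (√z)⁻¹ * (Real.log z / (1 + z)) with hF
    have hinv : ∫ z in Ioi (0 : ℝ), F z = 0 := by
      have h1 := integral_comp_rpow_Ioi F (p := -1) (by norm_num)
      have h2 : ∫ z in Ioi (0 : ℝ), (|(-1 : ℝ)| * z ^ ((-1 : ℝ) - 1)) • F (z ^ (-1 : ℝ)) =
          ∫ z in Ioi (0 : ℝ), -F z := by
        refine setIntegral_congr_fun measurableSet_Ioi fun z hz => ?_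
        have hz : 0 < z := hz
        have hs := Real.sqrt_pos.2 hz
        have h3 : z ^ ((-1 : ℝ) - 1) = (z ^ 2)⁻¹ := by
          rw [show (-1 : ℝ) - 1 = -((2 : ℕ) : ℝ) by norm_num, Real.rpow_neg hz.le,
            Real.rpow_natCast]
        simp only [hF, h3, Real.rpow_neg_one, Real.log_inv, Real.sqrt_inv, smul_eq_mul, abs_neg,
          abs_one, one_mul, inv_inv]
        have h4 := Real.sq_sqrt hz.le
        generalize Real.log z = l
        generalize √z = a at *
        subst h4
        field_simp
        ring
      rw [h2, integral_neg] at h1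
      linarith
    have hscale := integral_comp_mul_left_Ioi
      (fun z => (√z)⁻¹ * ((Real.log z - Real.log x) / (x + z))) 0 hx
    have h5 : ∫ t in Ioi (0 : ℝ), (√(x * t))⁻¹ * ((Real.log (x * t) - Real.log x) / (x + x * t)) =
        ∫ t in Ioi (0 : ℝ), ((√x)⁻¹ * x⁻¹) * F t := by
      refine setIntegral_congr_fun measurableSet_Ioi fun t ht => ?_
      have ht : 0 < t := ht
      simp only [hF]
      rw [Real.log_mul hx.ne' ht.ne', Real.sqrt_mul hx.le]
      have := Real.sqrt_pos.2 hx
      have := Real.sqrt_pos.2 ht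
      field_simp
      ring
    rw [h5, integral_const_mul, hinv, mul_zero, mul_zero, smul_eq_mul] at hscale
    exact (mul_eq_zero.1 hscale.symm).resolve_left (inv_ne_zero hx.ne')

/-- `∫₀^∞ z^{-1/2} log (z / y) / (x + z) dz = π x^{-1/2} log (x / y)`. -/
theorem integral_inv_sqrt_log_div_add {x : ℝ} (hx : 0 < x) (y : ℝ) :
    Integrable (fun z => (√z)⁻¹ * ((Real.log z - Real.log y) / (x + z))) posVolume ∧
      ∫ z, (√z)⁻¹ * ((Real.log z - Real.log y) / (x + z)) ∂posVolume =
        Real.pi * (√x)⁻¹ * (Real.log x - Real.log y) := by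
  obtain ⟨h1, h2⟩ := integral_inv_sqrt_log_div_add_self hx
  obtain ⟨h3, h4⟩ := integral_inv_sqrt_div_add hx
  have h5 := h3.const_mul (Real.log x - Real.log y)
  have h6 : (fun z => (√z)⁻¹ * ((Real.log z - Real.log y) / (x + z))) =
      fun z => (√z)⁻¹ * ((Real.log z - Real.log x) / (x + z)) +
        (Real.log x - Real.log y) * ((√z)⁻¹ / (x + z)) := by
    ext z
    ring
  rw [h6]
  refine ⟨h1.add h5, ?_⟩
  rw [integral_add h1 h5, h2, integral_const_mul, h4]
  ring

/-- A function which off `y` is a combination of the three basic logarithmic integrands is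
integrable, with the corresponding integral. -/
theorem integral_of_eq_log_comb {x y : ℝ} (hx : 0 < x) (hy : 0 < y) {k : ℝ → ℝ} (a b c : ℝ)
    (hk : ∀ z, 0 < z → z ≠ y → k z =
      a * ((√z)⁻¹ * ((Real.log z - Real.log y) / (z - y))) +
      b * ((√z)⁻¹ * ((Real.log z - Real.log y) / (y + z))) +
      c * ((√z)⁻¹ * ((Real.log z - Real.log y) / (x + z)))) :
    Integrable k posVolume ∧
    ∫ z, k z ∂posVolume =
      a * (Real.pi ^ 2 * (√y)⁻¹) + c * (Real.pi * (√x)⁻¹ * (Real.log x - Real.log y)) := by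
  obtain ⟨h1, h2⟩ := integral_inv_sqrt_log_div_sub hy
  obtain ⟨h3, h4⟩ := integral_inv_sqrt_log_div_add_self hy
  obtain ⟨h5, h6⟩ := integral_inv_sqrt_log_div_add hx y
  have k1 := h1.const_mul a
  have k2 := h3.const_mul b
  have k3 := h5.const_mul c
  have he := ((k1.add k2).add k3).congr (g := k) (by
    filter_upwards [ae_restrict_mem measurableSet_Ioi,
      ae_restrict_of_ae (Measure.ae_ne volume y)] with z hz hzy
    exact (hk z hz hzy).symm)
  refine ⟨he, ?_⟩
  have hi : ∫ z, k z ∂posVolume = _ := integral_congr_ae (g := _ + _ + _) (by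
    filter_upwards [ae_restrict_mem measurableSet_Ioi,
      ae_restrict_of_ae (Measure.ae_ne volume y)] with z hz hzy
    exact hk z hz hzy)
  rw [hi, integral_add' (k1.add k2) k3, integral_add' k1 k2, integral_const_mul,
    integral_const_mul, integral_const_mul, h2, h4, h6, mul_zero, add_zero]

/-- The nonnegative kernel `(2/π²) x^{-1/2} y^{3/2} log (x / y) / (x² - y²)`. -/
def dixonKernel (x y : ℝ) : ℝ :=
  2 / Real.pi ^ 2 * ((√x)⁻¹ * (y * √y) * ((Real.log x - Real.log y) / (x ^ 2 - y ^ 2)))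

theorem measurable_dixonKernel : Measurable (Function.uncurry dixonKernel) := by
  unfold Function.uncurry dixonKernel
  fun_prop

theorem log_sub_log_le {x y : ℝ} (hy : 0 < y) (hxy : y ≤ x) :
    Real.log x - Real.log y ≤ (x - y) / (√x * √y) := by
  have hx : 0 < x := hy.trans_le hxy
  have hsx := Real.sqrt_pos.2 hx
  have hsy := Real.sqrt_pos.2 hy
  have h1 : 1 ≤ √x / √y := (one_le_div hsy).2 (Real.sqrt_le_sqrt hxy)
  have h2 := Real.self_le_sinh_iff.2 (Real.log_nonneg h1)
  rw [Real.sinh_log (by positivity), Real.log_div hsx.ne' hsy.ne', Real.log_sqrt hx.le,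
    Real.log_sqrt hy.le] at h2
  have h3 : (x - y) / (√x * √y) = √x / √y - (√x / √y)⁻¹ := by
    have h4 := Real.sq_sqrt hx.le
    have h5 := Real.sq_sqrt hy.le
    field_simp
    rw [h4, h5]
  rw [h3]
  linarith

theorem log_sub_log_div_bounds {x y : ℝ} (hx : 0 < x) (hy : 0 < y) :
    0 ≤ (Real.log x - Real.log y) / (x ^ 2 - y ^ 2) ∧
      (Real.log x - Real.log y) / (x ^ 2 - y ^ 2) ≤ (√x * √y * (x + y))⁻¹ := by
  wlog hxy : y ≤ x generalizing x y
  · have h := this hy hx (not_le.1 hxy).le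
    rw [← neg_sub, ← neg_sub (x ^ 2), neg_div_neg_eq, mul_comm √y, add_comm y] at h
    exact h
  rcases hxy.eq_or_lt with rfl | hlt
  · simp only [sub_self, div_zero, le_refl, true_and]
    positivity
  have h0 : 0 < x ^ 2 - y ^ 2 := by nlinarith
  refine ⟨div_nonneg (sub_nonneg.2 (Real.log_le_log hy hxy)) h0.le, ?_⟩
  rw [div_le_iff₀ h0]
  refine (log_sub_log_le hy hxy).trans (le_of_eq ?_)
  have hsx := Real.sqrt_pos.2 hx
  have hsy := Real.sqrt_pos.2 hy
  field_simp
  ring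

theorem dixonKernel_nonneg {x y : ℝ} (hx : 0 < x) (hy : 0 < y) : 0 ≤ dixonKernel x y := by
  have := (log_sub_log_div_bounds hx hy).1
  unfold dixonKernel
  positivity

theorem dixonKernel_le {x y : ℝ} (hx : 0 < x) (hy : 0 < y) : dixonKernel x y ≤ 1 / x := by
  have h := (log_sub_log_div_bounds hx hy).2
  have hsx := Real.sqrt_pos.2 hx
  have hsy := Real.sqrt_pos.2 hy
  have hpi : 2 / Real.pi ^ 2 ≤ 1 := by
    rw [div_le_one (by positivity)]
    nlinarith [Real.pi_gt_three]
  calc dixonKernel x y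
      ≤ 1 * ((√x)⁻¹ * (y * √y) * (√x * √y * (x + y))⁻¹) := by
        unfold dixonKernel
        have := (log_sub_log_div_bounds hx hy).1
        gcongr
    _ = 1 / x * (y / (x + y)) := by
        have h4 := Real.sq_sqrt hx.le
        field_simp
        rw [h4]
    _ ≤ 1 / x * 1 := by
        gcongr
        rw [div_le_one (by positivity)]
        linarith
    _ = 1 / x := mul_one _

theorem integral_dixonKernel_div_add {x y : ℝ} (hx : 0 < x) (hy : 0 < y) (hxy : x ≠ y) :
    Integrable (fun z => dixonKernel z y / (x + z)) posVolume ∧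
      ∫ z, dixonKernel z y / (x + z) ∂posVolume =
        1 / (x + y) + Real.pi * dixonKernel x y := by
  have hxy' : x - y ≠ 0 := sub_ne_zero.2 hxy
  have hsx := Real.sqrt_pos.2 hx
  have hsy := Real.sqrt_pos.2 hy
  obtain ⟨h1, h2⟩ := integral_of_eq_log_comb hx hy (k := fun z => dixonKernel z y / (x + z))
    (2 / Real.pi ^ 2 * (y * √y) / (2 * y * (x + y)))
    (-(2 / Real.pi ^ 2 * (y * √y) / (2 * y * (x - y))))
    (2 / Real.pi ^ 2 * (y * √y) / ((x + y) * (x - y))) (by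
      intro z hz hzy
      have hzy' : z - y ≠ 0 := sub_ne_zero.2 hzy
      have hsz := Real.sqrt_pos.2 hz
      unfold dixonKernel
      generalize Real.log z - Real.log y = l
      rw [sq_sub_sq]
      field_simp
      ring)
  refine ⟨h1, ?_⟩
  rw [h2]
  unfold dixonKernel
  rw [sq_sub_sq]
  field_simp

theorem integral_dixonKernel_flip_div_add {x y : ℝ} (hx : 0 < x) (hy : 0 < y) (hxy : x ≠ y) :
    Integrable (fun z => dixonKernel y z / (x + z)) posVolume ∧
      ∫ z, dixonKernel y z / (x + z) ∂posVolume =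
        1 / (x + y) + Real.pi * dixonKernel y x := by
  have hxy' : x - y ≠ 0 := sub_ne_zero.2 hxy
  have hsx := Real.sqrt_pos.2 hx
  have hsy := Real.sqrt_pos.2 hy
  obtain ⟨h1, h2⟩ := integral_of_eq_log_comb hx hy (k := fun z => dixonKernel y z / (x + z))
    (2 / Real.pi ^ 2 * (√y)⁻¹ * y ^ 2 / (2 * y * (x + y)))
    (-(2 / Real.pi ^ 2 * (√y)⁻¹ * y ^ 2 / (2 * y * (x - y))))
    (2 / Real.pi ^ 2 * (√y)⁻¹ * x ^ 2 / ((x + y) * (x - y))) (by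
      intro z hz hzy
      have hzy' : z - y ≠ 0 := sub_ne_zero.2 hzy
      have hsz := Real.sqrt_pos.2 hz
      unfold dixonKernel
      rw [← neg_sub (Real.log z), ← neg_sub (z ^ 2), neg_div_neg_eq]
      generalize Real.log z - Real.log y = l
      rw [sq_sub_sq]
      have h4 := Real.sq_sqrt hz.le
      generalize √z = a at *
      subst h4
      field_simp
      ring)
  refine ⟨h1, ?_⟩
  rw [h2]
  unfold dixonKernel
  rw [← neg_sub (Real.log x), ← neg_sub (x ^ 2), neg_div_neg_eq]
  generalize Real.log x - Real.log y = l
  rw [sq_sub_sq]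
  have h4 := Real.sq_sqrt hx.le
  have h5 := Real.sq_sqrt hy.le
  generalize √x = a at *
  generalize √y = b at *
  subst h4 h5
  field_simp

theorem dixonKernel_flip_sub {x y : ℝ} (hx : 0 < x) (hy : 0 < y) (hxy : x ≠ y) :
    dixonKernel y x - dixonKernel x y =
      (√x)⁻¹ * (2 / Real.pi ^ 2 * (√y)⁻¹) * (Real.log x - Real.log y) := by
  have hxy' : x - y ≠ 0 := sub_ne_zero.2 hxy
  have hsx := Real.sqrt_pos.2 hx
  have hsy := Real.sqrt_pos.2 hy
  unfold dixonKernel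
  rw [← neg_sub (Real.log x), ← neg_sub (x ^ 2), neg_div_neg_eq]
  generalize Real.log x - Real.log y = l
  rw [sq_sub_sq]
  have h4 := Real.sq_sqrt hx.le
  have h5 := Real.sq_sqrt hy.le
  generalize √x = a at *
  generalize √y = b at *
  subst h4 h5
  field_simp
  ring

/-- The Stieltjes transform. -/
def stieltjes (h : ℝ → ℂ) (x : ℝ) : ℂ := ∫ y, h y / ((x : ℂ) + (y : ℂ)) ∂posVolume

/-- The integral operator on `(0,∞)` with kernel `Q`. -/
def kernelOp (Q : ℝ → ℝ → ℝ) (h : ℝ → ℂ) (x : ℝ) : ℂ := ∫ y, (Q x y : ℂ) * h y ∂posVolume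

theorem integrable_add_pi_mul {Q : ℝ → ℝ → ℝ} {h : ℝ → ℂ} {x : ℝ}
    (h1 : Integrable (fun y => h y / ((x : ℂ) + (y : ℂ))) posVolume)
    (h2 : Integrable (fun y => (Q x y : ℂ) * h y) posVolume) :
    Integrable (fun y => ((1 / (x + y) + Real.pi * Q x y : ℝ) : ℂ) * h y) posVolume ∧
      ∫ y, ((1 / (x + y) + Real.pi * Q x y : ℝ) : ℂ) * h y ∂posVolume =
        stieltjes h x + Real.pi * kernelOp Q h x := by
  have h3 := h2.const_mul (Real.pi : ℂ)
  have he : (fun y => ((1 / (x + y) + Real.pi * Q x y : ℝ) : ℂ) * h y) =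
      fun y => h y / ((x : ℂ) + (y : ℂ)) + (Real.pi : ℂ) * ((Q x y : ℂ) * h y) := by
    ext y
    push_cast
    ring
  rw [he]
  refine ⟨h1.add h3, ?_⟩
  rw [integral_add h1 h3, integral_const_mul, stieltjes, kernelOp]

theorem stieltjes_kernelOp {Q : ℝ → ℝ → ℝ} (hm : Measurable (Function.uncurry Q))
    (h0 : ∀ x y, 0 < x → 0 < y → 0 ≤ Q x y) {x : ℝ} (hx : 0 < x)
    (hQ : ∀ y, 0 < y → x ≠ y → Integrable (fun z => Q z y / (x + z)) posVolume ∧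
      ∫ z, Q z y / (x + z) ∂posVolume = 1 / (x + y) + Real.pi * Q x y)
    {h : ℝ → ℂ} (hh : AEStronglyMeasurable h posVolume)
    (h1 : Integrable (fun y => h y / ((x : ℂ) + (y : ℂ))) posVolume)
    (h2 : Integrable (fun y => (Q x y : ℂ) * h y) posVolume) :
    Integrable (fun z => kernelOp Q h z / ((x : ℂ) + (z : ℂ))) posVolume ∧
      stieltjes (kernelOp Q h) x = stieltjes h x + Real.pi * kernelOp Q h x := by
  obtain ⟨hi, hv⟩ := integrable_add_pi_mul h1 h2
  obtain ⟨k1, k2⟩ := integral_kernel_swap (W := fun z y => Q z y / (x + z))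
    (by
      have : Measurable fun p : ℝ × ℝ => Q p.1 p.2 / (x + p.1) :=
        hm.div (measurable_const.add measurable_fst)
      exact this)
    (fun z y hz hy => div_nonneg (h0 z y hz hy) (by positivity)) hh
    (by
      filter_upwards [ae_restrict_mem measurableSet_Ioi,
        ae_restrict_of_ae (Measure.ae_ne volume x)] with y hy hyx
      exact hQ y hy hyx.symm) hi
  have he : (fun z => ∫ y, ((Q z y / (x + z) : ℝ) : ℂ) * h y ∂posVolume) =
      fun z => kernelOp Q h z / ((x : ℂ) + (z : ℂ)) := by
    ext z
    rw [kernelOp, ← integral_div]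
    congr 1
    ext y
    push_cast
    ring
  rw [he] at k1 k2
  exact ⟨k1, k2.trans hv⟩

theorem kernelOp_stieltjes {Q : ℝ → ℝ → ℝ} (hm : Measurable (Function.uncurry Q))
    (h0 : ∀ x y, 0 < x → 0 < y → 0 ≤ Q x y) {x : ℝ} (hx : 0 < x)
    (hQ : ∀ y, 0 < y → y ≠ x → Integrable (fun z => Q x z / (y + z)) posVolume ∧
      ∫ z, Q x z / (y + z) ∂posVolume = 1 / (y + x) + Real.pi * Q x y)
    {h : ℝ → ℂ} (hh : AEStronglyMeasurable h posVolume)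
    (h1 : Integrable (fun y => h y / ((x : ℂ) + (y : ℂ))) posVolume)
    (h2 : Integrable (fun y => (Q x y : ℂ) * h y) posVolume) :
    Integrable (fun z => (Q x z : ℂ) * stieltjes h z) posVolume ∧
      kernelOp Q (stieltjes h) x = stieltjes h x + Real.pi * kernelOp Q h x := by
  obtain ⟨hi, hv⟩ := integrable_add_pi_mul h1 h2
  obtain ⟨k1, k2⟩ := integral_kernel_swap (W := fun z y => Q x z / (y + z))
    (J := fun y => 1 / (x + y) + Real.pi * Q x y)
    (by
      have : Measurable fun p : ℝ × ℝ => Q x p.1 / (p.2 + p.1) :=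
        (hm.comp (measurable_const.prodMk measurable_fst)).div
          (measurable_snd.add measurable_fst)
      exact this)
    (fun z y hz hy => div_nonneg (h0 x z hx hz) (by positivity)) hh
    (by
      filter_upwards [ae_restrict_mem measurableSet_Ioi,
        ae_restrict_of_ae (Measure.ae_ne volume x)] with y hy hyx
      rw [add_comm x y]
      exact hQ y hy hyx) hi
  have he : (fun z => ∫ y, ((Q x z / (y + z) : ℝ) : ℂ) * h y ∂posVolume) =
      fun z => (Q x z : ℂ) * stieltjes h z := by
    ext z
    rw [stieltjes, ← integral_const_mul]
    congr 1
    ext y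
    push_cast
    ring
  rw [he] at k1 k2
  exact ⟨k1, k2.trans hv⟩

theorem MemE.aestronglyMeasurable {f : ℝ → ℂ} (hf : MemE f) :
    AEStronglyMeasurable f posVolume := by
  have h1 : AEStronglyMeasurable (fun x : ℝ => (1 + (x : ℂ))) posVolume :=
    Measurable.aestronglyMeasurable (by fun_prop)
  refine ((Integrable.aestronglyMeasurable hf).mul h1).congr ?_
  filter_upwards [ae_restrict_mem measurableSet_Ioi] with x hx
  have hx : 0 < x := hx
  have : 1 + (x : ℂ) ≠ 0 := by
    norm_cast
    positivity
  simp [div_mul_cancel₀ _ this]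

theorem MemE.integrable_div_add {f : ℝ → ℂ} (hf : MemE f) {x : ℝ} (hx : 0 < x) :
    Integrable (fun y => f y / ((x : ℂ) + (y : ℂ))) posVolume := by
  have hm : AEStronglyMeasurable (fun y : ℝ => (x : ℂ) + (y : ℂ)) posVolume :=
    Measurable.aestronglyMeasurable (by fun_prop)
  refine Integrable.mono' (hf.norm.const_mul (1 + 1 / x)) (hf.aestronglyMeasurable.div₀ hm) ?_
  filter_upwards [ae_restrict_mem measurableSet_Ioi] with y hy
  have hy : 0 < y := hy
  have e1 : ‖(x : ℂ) + (y : ℂ)‖ = x + y := by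
    rw [← Complex.ofReal_add, Complex.norm_of_nonneg (by positivity)]
  have e2 : ‖1 + (y : ℂ)‖ = 1 + y := by
    rw [← Complex.ofReal_one, ← Complex.ofReal_add, Complex.norm_of_nonneg (by positivity)]
  rw [norm_div, norm_div, e1, e2, mul_div_assoc', div_le_div_iff₀ (by positivity) (by positivity)]
  have : 1 + y ≤ (1 + 1 / x) * (x + y) := by
    have : (1 + 1 / x) * (x + y) = 1 + y + x + y / x := by
      field_simp
      ring
    rw [this]
    have : 0 < y / x := by positivity
    linarith
  calc ‖f y‖ * (1 + y) ≤ ‖f y‖ * ((1 + 1 / x) * (x + y)) := by gcongr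
    _ = _ := by ring

theorem memE_of_integrable_div_add {f : ℝ → ℂ}
    (hf : ∀ x : ℝ, 0 < x → Integrable (fun y => f y / ((x : ℂ) + (y : ℂ))) posVolume) :
    MemE f := by
  have := hf 1 one_pos
  rwa [Complex.ofReal_one] at this

theorem AdmissiblePair.exists_bounds {φ₁ φ₂ : ℝ → ℝ} (hφ : AdmissiblePair φ₁ φ₂) :
    ∃ C : ℝ, 0 ≤ C ∧ ∀ y, 0 < y → φ₁ y ≤ C / (1 + y) ∧ φ₂ y / y ≤ C / (1 + y) := by
  obtain ⟨-, -, h3, h4, h5⟩ := hφ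
  obtain ⟨a, ha⟩ := h4.bound
  obtain ⟨b, hb⟩ := h5.bound
  obtain ⟨N, hN⟩ := Filter.eventually_atTop.1 ha
  obtain ⟨δ, hδ0, hδ⟩ := mem_nhdsGT_iff_exists_Ioo_subset.1 hb
  have hδ0 : 0 < δ := hδ0
  refine ⟨(1 + |N|) + 2 * |a| + (1 + δ⁻¹) + |b| * (1 + δ), by positivity, fun y hy => ?_⟩
  obtain ⟨⟨p1, p2⟩, ⟨p3, p4⟩, p5⟩ := h3 y hy
  constructor
  · rw [le_div_iff₀ (by positivity)]
    have hn : 0 ≤ δ⁻¹ + |b| * (1 + δ) := by positivity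
    have ha0 := abs_nonneg a
    have hN0 := abs_nonneg N
    rcases le_total y (max N 1) with h | h
    · have h6 : y ≤ 1 + |N| := h.trans (max_le ((le_abs_self N).trans (by linarith)) (by linarith))
      nlinarith
    · have h7 := hN y ((le_max_left _ _).trans h)
      have h8 : 1 ≤ y := (le_max_right _ _).trans h
      simp only [Real.norm_eq_abs, abs_of_pos p1, abs_of_pos (one_div_pos.2 hy)] at h7
      have h9 : φ₁ y * y ≤ |a| := by
        rw [mul_one_div, le_div_iff₀ hy] at h7
        exact h7.trans (le_abs_self a)
      nlinarith
  · rw [div_le_div_iff₀ hy (by positivity)]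
    have ha0 := abs_nonneg a
    have hN0 := abs_nonneg N
    have hb0 := abs_nonneg b
    rcases lt_or_ge y δ with h | h
    · have h7 := hδ ⟨hy, h⟩
      simp only [mem_ofPred_eq, Real.norm_eq_abs, abs_of_pos hy] at h7
      rw [show φ₁ y - 1 = -φ₂ y by linarith, abs_neg, abs_of_pos p3] at h7
      have h8 : φ₂ y ≤ |b| * y := h7.trans (by gcongr; exact le_abs_self b)
      calc φ₂ y * (1 + y) ≤ |b| * y * (1 + δ) := by gcongr
        _ = (|b| * (1 + δ)) * y := by ring
        _ ≤ _ := by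
          have : 0 ≤ δ⁻¹ := by positivity
          exact mul_le_mul_of_nonneg_right (by linarith) hy.le
    · have h8 : 1 ≤ δ⁻¹ * y := by
        rw [inv_mul_eq_div]
        exact (one_le_div hδ0).2 h
      calc φ₂ y * (1 + y) ≤ 1 * (1 + y) := by gcongr
        _ ≤ (1 + δ⁻¹) * y := by linarith
        _ ≤ _ := by
          have : 0 ≤ |b| * (1 + δ) := by positivity
          exact mul_le_mul_of_nonneg_right (by linarith) hy.le

theorem MemE.integrable_admissible {φ₁ φ₂ : ℝ → ℝ} (hφ : AdmissiblePair φ₁ φ₂) {f : ℝ → ℂ}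
    (hf : MemE f) :
    Integrable (fun y => (φ₁ y : ℂ) * f y) posVolume ∧
      Integrable (fun y => ((φ₂ y : ℂ) * f y) / (y : ℂ)) posVolume := by
  obtain ⟨C, hC0, hC⟩ := hφ.exists_bounds
  have hm := hf.aestronglyMeasurable
  have m1 : AEStronglyMeasurable (fun y => (φ₁ y : ℂ)) posVolume :=
    Complex.continuous_ofReal.comp_aestronglyMeasurable
      (hφ.1.aestronglyMeasurable measurableSet_Ioi)
  have m2 : AEStronglyMeasurable (fun y => (φ₂ y : ℂ)) posVolume :=
    Complex.continuous_ofReal.comp_aestronglyMeasurable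
      (hφ.2.1.aestronglyMeasurable measurableSet_Ioi)
  have m3 : AEStronglyMeasurable (fun y : ℝ => (y : ℂ)) posVolume :=
    Measurable.aestronglyMeasurable (by fun_prop)
  have hn : ∀ y : ℝ, 0 < y → C * ‖f y / (1 + (y : ℂ))‖ = C / (1 + y) * ‖f y‖ := by
    intro y hy
    have e2 : ‖1 + (y : ℂ)‖ = 1 + y := by
      rw [← Complex.ofReal_one, ← Complex.ofReal_add, Complex.norm_of_nonneg (by positivity)]
    rw [norm_div, e2]
    ring
  constructor
  · refine Integrable.mono' (hf.norm.const_mul C) (m1.mul hm) ?_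
    filter_upwards [ae_restrict_mem measurableSet_Ioi] with y hy
    rw [hn y hy, norm_mul, Complex.norm_of_nonneg (hφ.2.2.1 y hy).1.1.le]
    gcongr
    exact (hC y hy).1
  · refine Integrable.mono' (hf.norm.const_mul C) ((m2.mul hm).div₀ m3) ?_
    filter_upwards [ae_restrict_mem measurableSet_Ioi] with y hy
    have hy' : 0 < y := hy
    rw [hn y hy, norm_div, norm_mul, Complex.norm_of_nonneg (hφ.2.2.1 y hy).2.1.1.le,
      Complex.norm_of_nonneg hy'.le, mul_div_right_comm]
    exact mul_le_mul_of_nonneg_right (hC y hy).2 (norm_nonneg _)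

theorem integrable_ofReal_mul_of_le {w k : ℝ → ℝ} {h : ℝ → ℂ} {C : ℝ}
    (hw : Integrable (fun y => (w y : ℂ) * h y) posVolume) (hk : Measurable k)
    (hh : AEStronglyMeasurable h posVolume)
    (h0 : ∀ y, 0 < y → 0 ≤ k y) (hle : ∀ y, 0 < y → k y ≤ C * w y) :
    Integrable (fun y => (k y : ℂ) * h y) posVolume := by
  have m1 : AEStronglyMeasurable (fun y => (k y : ℂ)) posVolume :=
    (Complex.measurable_ofReal.comp hk).aestronglyMeasurable
  refine Integrable.mono (hw.const_mul (C : ℂ)) (m1.mul hh) ?_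
  filter_upwards [ae_restrict_mem measurableSet_Ioi] with y hy
  rw [← mul_assoc, ← Complex.ofReal_mul, norm_mul, norm_mul, Complex.norm_of_nonneg (h0 y hy),
    Complex.norm_of_nonneg ((h0 y hy).trans (hle y hy))]
  exact mul_le_mul_of_nonneg_right (hle y hy) (norm_nonneg _)

theorem integrable_dixonKernel_mul {h : ℝ → ℂ} (hh : Integrable h posVolume) {x : ℝ}
    (hx : 0 < x) : Integrable (fun y => (dixonKernel x y : ℂ) * h y) posVolume := by
  refine integrable_ofReal_mul_of_le (w := fun _ => 1) (C := 1 / x) (by simpa using hh)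
    (measurable_dixonKernel.comp (measurable_const.prodMk measurable_id))
    hh.aestronglyMeasurable (fun y hy => dixonKernel_nonneg hx hy) fun y hy => ?_
  rw [mul_one]
  exact dixonKernel_le hx hy

theorem integrable_dixonKernel_flip_mul {h : ℝ → ℂ} (hm : AEStronglyMeasurable h posVolume)
    (hh : Integrable (fun y => h y / (y : ℂ)) posVolume) {x : ℝ}
    (hx : 0 < x) : Integrable (fun y => (dixonKernel y x : ℂ) * h y) posVolume := by
  refine integrable_ofReal_mul_of_le (w := fun y => 1 / y) (C := 1)
    (hh.congr (Filter.Eventually.of_forall fun y => ?_))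
    (measurable_dixonKernel.comp (measurable_id.prodMk measurable_const))
    hm (fun y hy => dixonKernel_nonneg hy hx) fun y hy => ?_
  · push_cast
    ring
  · rw [one_mul]
    exact dixonKernel_le hy hx

/-- The splitting of an element of `E` along an admissible pair, with everything needed to apply
the two resolvent kernels to its parts. -/
theorem MemE.split {φ₁ φ₂ : ℝ → ℝ} (hφ : AdmissiblePair φ₁ φ₂) {f : ℝ → ℂ} (hf : MemE f) :
    ∃ f₁ f₂ : ℝ → ℂ, (∀ y, f₁ y = (φ₁ y : ℂ) * f y) ∧ (∀ y, f₂ y = (φ₂ y : ℂ) * f y) ∧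
      (∀ y, 0 < y → f y = f₁ y + f₂ y) ∧
      AEStronglyMeasurable f₁ posVolume ∧ AEStronglyMeasurable f₂ posVolume ∧
      ∀ x : ℝ, 0 < x →
        Integrable (fun y => f₁ y / ((x : ℂ) + (y : ℂ))) posVolume ∧
        Integrable (fun y => f₂ y / ((x : ℂ) + (y : ℂ))) posVolume ∧
        stieltjes f x = stieltjes f₁ x + stieltjes f₂ x ∧
        Integrable (fun y => (dixonKernel x y : ℂ) * f₁ y) posVolume ∧
        Integrable (fun y => (dixonKernel y x : ℂ) * f₂ y) posVolume := by
  obtain ⟨h1, h2⟩ := hf.integrable_admissible hφ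
  have m2 : AEStronglyMeasurable (fun y => (φ₂ y : ℂ) * f y) posVolume :=
    (Complex.continuous_ofReal.comp_aestronglyMeasurable
      (hφ.2.1.aestronglyMeasurable measurableSet_Ioi)).mul hf.aestronglyMeasurable
  have hs : ∀ y, 0 < y → f y = (φ₁ y : ℂ) * f y + (φ₂ y : ℂ) * f y := by
    intro y hy
    rw [← add_mul, ← Complex.ofReal_add, (hφ.2.2.1 y hy).2.2, Complex.ofReal_one, one_mul]
  refine ⟨_, _, fun _ => rfl, fun _ => rfl, hs, h1.aestronglyMeasurable, m2, fun x hx => ?_⟩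
  have i1 : Integrable (fun y => ((φ₁ y : ℂ) * f y) / ((x : ℂ) + (y : ℂ))) posVolume := by
    have := integrable_ofReal_mul_of_le (w := fun _ => 1) (k := fun y => |(x + y)⁻¹|) (C := 1 / x)
      (h := fun y => (φ₁ y : ℂ) * f y) (by simpa using h1) (by fun_prop)
      h1.aestronglyMeasurable (fun y hy => abs_nonneg _) (fun y hy => by
        rw [abs_of_pos (by positivity), mul_one, ← one_div]
        exact one_div_le_one_div_of_le hx (by linarith))
    refine this.congr ?_
    filter_upwards [ae_restrict_mem measurableSet_Ioi] with y hy
    have hy : 0 < y := hy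
    rw [abs_of_pos (by positivity)]
    push_cast
    ring
  have i0 := hf.integrable_div_add hx
  have i2 : Integrable (fun y => ((φ₂ y : ℂ) * f y) / ((x : ℂ) + (y : ℂ))) posVolume := by
    refine (i0.sub i1).congr ?_
    filter_upwards [ae_restrict_mem measurableSet_Ioi] with y hy
    have := hs y hy
    simp only [Pi.sub_apply]
    rw [← sub_div, sub_eq_of_eq_add' this]
  refine ⟨i1, i2, ?_, integrable_dixonKernel_mul h1 hx, integrable_dixonKernel_flip_mul m2 h2 hx⟩
  unfold stieltjes
  rw [← integral_add i1 i2]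
  refine integral_congr_ae ?_
  filter_upwards [ae_restrict_mem measurableSet_Ioi] with y hy
  rw [← add_div, ← hs y hy]

/-- The kernel of `1 - π⁻¹ stieltjes` in `E`. -/
theorem exists_eq_of_eq_stieltjes {φ₁ φ₂ : ℝ → ℝ} (hφ : AdmissiblePair φ₁ φ₂) {d : ℝ → ℂ}
    (hd : MemE d) (hdS : ∀ᵐ x ∂posVolume, d x = (Real.pi : ℂ)⁻¹ * stieltjes d x) :
    ∃ A B : ℂ, ∀ᵐ x ∂posVolume,
      d x = (((√x)⁻¹ : ℝ) : ℂ) * (A + B * (Real.log x : ℂ)) := by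
  have hpi : (Real.pi : ℂ) ≠ 0 := Complex.ofReal_ne_zero.2 Real.pi_ne_zero
  obtain ⟨d₁, d₂, -, -, hsum, m1, m2, hsplit⟩ := hd.split hφ
  set m : ℝ → ℂ := fun y => d₁ y - (Real.pi : ℂ)⁻¹ * stieltjes d₁ y with hm
  have hm2 : ∀ᵐ y ∂posVolume, m y = (Real.pi : ℂ)⁻¹ * stieltjes d₂ y - d₂ y := by
    filter_upwards [ae_restrict_mem measurableSet_Ioi, hdS] with y hy hyS
    rw [hsum y hy, (hsplit y hy).2.2.1] at hyS
    simp only [hm]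
    linear_combination hyS
  set n : ℝ → ℂ := fun y => ((2 / Real.pi ^ 2 * (√y)⁻¹ : ℝ) : ℂ) * m y with hn
  have key : ∀ x : ℝ, 0 < x →
      Integrable (fun y => ((Real.log x - Real.log y : ℝ) : ℂ) * n y) posVolume ∧
      (Real.pi : ℂ)⁻¹ * stieltjes d x =
        (((√x)⁻¹ : ℝ) : ℂ) * ∫ y, ((Real.log x - Real.log y : ℝ) : ℂ) * n y ∂posVolume := by
    intro x hx
    obtain ⟨a1, a2, a3, a4, a5⟩ := hsplit x hx
    obtain ⟨b1, b2⟩ := kernelOp_stieltjes measurable_dixonKernel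
      (fun _ _ => dixonKernel_nonneg) hx (fun y hy hyx =>
        integral_dixonKernel_flip_div_add hy hx hyx) m1 a1 a4
    obtain ⟨c1, c2⟩ := kernelOp_stieltjes (Q := fun x y => dixonKernel y x)
      (measurable_dixonKernel.comp measurable_swap)
      (fun _ _ hx hy => dixonKernel_nonneg hy hx) hx (fun y hy hyx =>
        integral_dixonKernel_div_add hy hx hyx) m2 a2 a5
    have e1 : Integrable (fun y => (dixonKernel x y : ℂ) * m y) posVolume ∧
        ∫ y, (dixonKernel x y : ℂ) * m y ∂posVolume = -((Real.pi : ℂ)⁻¹ * stieltjes d₁ x) := by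
      have i := b1.const_mul (Real.pi : ℂ)⁻¹
      have he : (fun y => (dixonKernel x y : ℂ) * m y) = fun y =>
          (dixonKernel x y : ℂ) * d₁ y -
            (Real.pi : ℂ)⁻¹ * ((dixonKernel x y : ℂ) * stieltjes d₁ y) := by
        ext y
        simp only [hm]
        ring
      rw [he]
      refine ⟨a4.sub i, ?_⟩
      rw [integral_sub a4 i, integral_const_mul]
      simp only [kernelOp] at b2
      rw [b2]
      field_simp
      ring
    have e2 : Integrable (fun y => (dixonKernel y x : ℂ) * m y) posVolume ∧
        ∫ y, (dixonKernel y x : ℂ) * m y ∂posVolume = (Real.pi : ℂ)⁻¹ * stieltjes d₂ x := by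
      have i := c1.const_mul (Real.pi : ℂ)⁻¹
      have he : (fun y => (dixonKernel y x : ℂ) * m y) =ᵐ[posVolume] fun y =>
          (Real.pi : ℂ)⁻¹ * ((dixonKernel y x : ℂ) * stieltjes d₂ y) -
            (dixonKernel y x : ℂ) * d₂ y := by
        filter_upwards [hm2] with y hy
        rw [hy]
        ring
      refine ⟨(i.sub a5).congr he.symm, ?_⟩
      rw [integral_congr_ae he, integral_sub i a5, integral_const_mul]
      simp only [kernelOp] at c2
      rw [c2]
      field_simp
      ring
    have hs : (((√x)⁻¹ : ℝ) : ℂ) ≠ 0 :=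
      Complex.ofReal_ne_zero.2 (inv_ne_zero (Real.sqrt_pos.2 hx).ne')
    have he : (fun y => (dixonKernel y x : ℂ) * m y - (dixonKernel x y : ℂ) * m y)
        =ᵐ[posVolume] fun y =>
        (((√x)⁻¹ : ℝ) : ℂ) * (((Real.log x - Real.log y : ℝ) : ℂ) * n y) := by
      filter_upwards [ae_restrict_mem measurableSet_Ioi,
        ae_restrict_of_ae (Measure.ae_ne volume x)] with y hy hyx
      rw [← sub_mul, ← Complex.ofReal_sub, dixonKernel_flip_sub hx hy hyx.symm]
      simp only [hn]
      push_cast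
      ring
    refine ⟨?_, ?_⟩
    · refine (((e2.1.sub e1.1).congr he).const_mul (((√x)⁻¹ : ℝ) : ℂ)⁻¹).congr
        (Filter.Eventually.of_forall fun y => ?_)
      simp only [inv_mul_cancel_left₀ hs]
    · rw [← integral_const_mul, ← integral_congr_ae he, integral_sub e2.1 e1.1, e1.2, e2.2, a3]
      ring
  have hlog : Integrable (fun y => (Real.log y : ℂ) * n y) posVolume := by
    refine (key 1 one_pos).1.neg.congr (Filter.Eventually.of_forall fun y => ?_)
    simp
  have hn1 : Integrable n posVolume := by
    refine ((key (Real.exp 1) (Real.exp_pos 1)).1.add hlog).congr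
      (Filter.Eventually.of_forall fun y => ?_)
    simp only [Pi.add_apply, Real.log_exp]
    push_cast
    ring
  refine ⟨-∫ y, (Real.log y : ℂ) * n y ∂posVolume, ∫ y, n y ∂posVolume, ?_⟩
  filter_upwards [ae_restrict_mem measurableSet_Ioi, hdS] with x hx hxS
  have i := hn1.const_mul (Real.log x : ℂ)
  rw [hxS, (key x hx).2]
  congr 1
  have he : (fun y => ((Real.log x - Real.log y : ℝ) : ℂ) * n y) =
      fun y => (Real.log x : ℂ) * n y - (Real.log y : ℂ) * n y := by
    ext y
    push_cast
    ring
  rw [he, integral_sub i hlog, integral_const_mul]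
  ring

/-- The functions `x^{-1/2} (A + B log x)` are eigenfunctions of the Stieltjes transform. -/
theorem stieltjes_inv_sqrt_mul_log (A B : ℂ) {x : ℝ} (hx : 0 < x) :
    Integrable (fun y => ((((√y)⁻¹ : ℝ) : ℂ) * (A + B * (Real.log y : ℂ))) /
      ((x : ℂ) + (y : ℂ))) posVolume ∧
    stieltjes (fun y => (((√y)⁻¹ : ℝ) : ℂ) * (A + B * (Real.log y : ℂ))) x =
      Real.pi * ((((√x)⁻¹ : ℝ) : ℂ) * (A + B * (Real.log x : ℂ))) := by
  obtain ⟨h1, h2⟩ := integral_inv_sqrt_div_add hx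
  obtain ⟨h3, h4⟩ := integral_inv_sqrt_log_div_add hx 1
  have i1 : Integrable (fun y => A * (((√y)⁻¹ / (x + y) : ℝ) : ℂ)) posVolume :=
    h1.ofReal.const_mul A
  have i2 : Integrable (fun y => B *
      (((√y)⁻¹ * ((Real.log y - Real.log 1) / (x + y)) : ℝ) : ℂ)) posVolume :=
    h3.ofReal.const_mul B
  have he : (fun y : ℝ => ((((√y)⁻¹ : ℝ) : ℂ) * (A + B * (Real.log y : ℂ))) /
      ((x : ℂ) + (y : ℂ))) = fun y => A * (((√y)⁻¹ / (x + y) : ℝ) : ℂ) + B *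
      (((√y)⁻¹ * ((Real.log y - Real.log 1) / (x + y)) : ℝ) : ℂ) := by
    ext y
    push_cast
    simp only [Real.log_one, Complex.ofReal_zero]
    ring
  unfold stieltjes
  rw [he]
  refine ⟨i1.add i2, ?_⟩
  rw [integral_add i1 i2, integral_const_mul, integral_const_mul, integral_complex_ofReal,
    integral_complex_ofReal, h2, h4]
  push_cast
  simp only [Real.log_one, Complex.ofReal_zero]
  ring

/-- The combined resolvent kernel yields a solution of the Stieltjes equation in `E`. -/
theorem resolvent_memE_and_eq {φ₁ φ₂ : ℝ → ℝ} (hφ : AdmissiblePair φ₁ φ₂) {g : ℝ → ℂ}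
    (hg : MemE g) {f : ℝ → ℂ}
    (hf : ∀ x, f x = g x - ∫ y, ((dixonKernel x y : ℂ) * ((φ₁ y : ℂ) * g y) +
      (dixonKernel y x : ℂ) * ((φ₂ y : ℂ) * g y)) ∂posVolume) :
    MemE f ∧ ∀ x, 0 < x → f x = g x + (Real.pi : ℂ)⁻¹ * stieltjes f x := by
  have hpi : (Real.pi : ℂ) ≠ 0 := Complex.ofReal_ne_zero.2 Real.pi_ne_zero
  obtain ⟨g₁, g₂, hg₁, hg₂, -, m1, m2, hsplit⟩ := hg.split hφ
  have hf' : ∀ x, 0 < x → f x = g x - (kernelOp dixonKernel g₁ x +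
      kernelOp (fun x y => dixonKernel y x) g₂ x) := by
    intro x hx
    obtain ⟨-, -, -, a4, a5⟩ := hsplit x hx
    rw [hf, kernelOp, kernelOp, ← integral_add a4 a5]
    simp only [hg₁, hg₂]
  have key : ∀ x : ℝ, 0 < x → Integrable (fun y => f y / ((x : ℂ) + (y : ℂ))) posVolume ∧
      stieltjes f x = Real.pi * (f x - g x) := by
    intro x hx
    obtain ⟨a1, a2, a3, a4, a5⟩ := hsplit x hx
    obtain ⟨b1, b2⟩ := stieltjes_kernelOp measurable_dixonKernel
      (fun _ _ => dixonKernel_nonneg) hx (fun y hy hxy =>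
        integral_dixonKernel_div_add hx hy hxy) m1 a1 a4
    obtain ⟨c1, c2⟩ := stieltjes_kernelOp (Q := fun x y => dixonKernel y x)
      (measurable_dixonKernel.comp measurable_swap)
      (fun _ _ hx hy => dixonKernel_nonneg hy hx) hx (fun y hy hxy =>
        integral_dixonKernel_flip_div_add hx hy hxy) m2 a2 a5
    have i0 := hg.integrable_div_add hx
    have he : (fun y => f y / ((x : ℂ) + (y : ℂ))) =ᵐ[posVolume] fun y =>
        g y / ((x : ℂ) + (y : ℂ)) - (kernelOp dixonKernel g₁ y / ((x : ℂ) + (y : ℂ)) +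
          kernelOp (fun x y => dixonKernel y x) g₂ y / ((x : ℂ) + (y : ℂ))) := by
      filter_upwards [ae_restrict_mem measurableSet_Ioi] with y hy
      rw [hf' y hy]
      ring
    refine ⟨(i0.sub (b1.add c1)).congr he.symm, ?_⟩
    unfold stieltjes at a3 b2 c2 ⊢
    rw [integral_congr_ae he, integral_sub i0, integral_add b1 c1, b2, c2, a3, hf' x hx]
    · ring
    · exact b1.add c1
  refine ⟨memE_of_integrable_div_add fun x hx => (key x hx).1, fun x hx => ?_⟩
  rw [(key x hx).2]
  field_simp
  ring

theorem ofReal_cpow_one_half {x : ℝ} (hx : 0 ≤ x) : (x : ℂ) ^ ((1 : ℂ) / 2) = ((√x : ℝ) : ℂ) := by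
  rw [Real.sqrt_eq_rpow, Complex.ofReal_cpow hx]
  norm_num

theorem ofReal_cpow_neg_one_half {x : ℝ} (hx : 0 ≤ x) :
    (x : ℂ) ^ (-(1 / 2) : ℂ) = (((√x)⁻¹ : ℝ) : ℂ) := by
  rw [Complex.cpow_neg, ofReal_cpow_one_half hx, Complex.ofReal_inv]

theorem resolvent_integrand_eq {x y : ℝ} (hx : 0 < x) (hy : 0 < y) (a b : ℝ) (w : ℂ) :
    ((a * (y / x) + b * (x / y) : ℝ) : ℂ) * (1 / ((x : ℂ) ^ 2 - (y : ℂ) ^ 2)) *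
        ((y / x : ℝ) : ℂ) ^ ((1 : ℂ) / 2) * (Real.log (y / x) : ℂ) * w =
      ((-(Real.pi ^ 2 / (2 * x)) : ℝ) : ℂ) *
        ((dixonKernel x y : ℂ) * ((a : ℂ) * w) + (dixonKernel y x : ℂ) * ((b : ℂ) * w)) := by
  have hreal : (a * (y / x) + b * (x / y)) * (1 / (x ^ 2 - y ^ 2)) * √(y / x) *
      Real.log (y / x) = -(Real.pi ^ 2 / (2 * x)) * (dixonKernel x y * a + dixonKernel y x * b) := by
    have hsx := Real.sqrt_pos.2 hx
    have hsy := Real.sqrt_pos.2 hy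
    unfold dixonKernel
    rw [← neg_sub (Real.log x) (Real.log y), ← neg_sub (x ^ 2) (y ^ 2), neg_div_neg_eq,
      Real.log_div hy.ne' hx.ne', ← neg_sub (Real.log x) (Real.log y), Real.sqrt_div hy.le,
      one_div, div_eq_mul_inv _ (x ^ 2 - y ^ 2)]
    generalize (x ^ 2 - y ^ 2)⁻¹ = D
    generalize Real.log x - Real.log y = l
    have h4 := Real.sq_sqrt hx.le
    have h5 := Real.sq_sqrt hy.le
    generalize √x = s at *
    generalize √y = t at *
    subst h4 h5
    field_simp
  rw [ofReal_cpow_one_half (by positivity)]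
  calc _ = (((a * (y / x) + b * (x / y)) * (1 / (x ^ 2 - y ^ 2)) * √(y / x) *
      Real.log (y / x) : ℝ) : ℂ) * w := by
        push_cast
        ring
    _ = _ := by
        rw [hreal]
        push_cast
        ring

/-- Theorem 1(iv): for `λ = 1/π`, `g ∈ E` and an admissible weight pair
`(φ₁, φ₂)`, a function `f ∈ E` satisfies the Stieltjes equation a.e. iff there are
constants `A, B` with
`f(x) = g(x) + (2/π²)·x·∫₀^∞ (φ₁(y)(y/x) + φ₂(y)(x/y))·(y/x)^{1/2}·ln(y/x)/(x²-y²)·g(y) dy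
  + x^{-1/2}(A + B ln x)` a.e. -/
theorem stmt12 (lam : ℂ) (hlam : lam = 1 / (Real.pi : ℂ))
    (g : ℝ → ℂ) (hg : MemE g)
    (φ₁ φ₂ : ℝ → ℝ) (hφ : AdmissiblePair φ₁ φ₂) (f : ℝ → ℂ) (hf : MemE f) :
    ((∀ x : ℝ, 0 < x → IntegrableOn (fun y : ℝ => f y / ((x : ℂ) + (y : ℂ))) (Ioi 0)) ∧
      (∀ᵐ x ∂(volume.restrict (Ioi (0 : ℝ))),
        f x = g x + lam * ∫ y in Ioi (0 : ℝ), f y / ((x : ℂ) + (y : ℂ))))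
    ↔
    ((∀ x : ℝ, 0 < x → IntegrableOn (fun y : ℝ =>
        ((φ₁ y * (y / x) + φ₂ y * (x / y) : ℝ) : ℂ) *
          (1 / ((x : ℂ) ^ 2 - (y : ℂ) ^ 2)) * ((y / x : ℝ) : ℂ) ^ ((1 : ℂ)/2) *
          (Real.log (y / x) : ℂ) * g y) (Ioi 0)) ∧
      ∃ A B : ℂ, (∀ᵐ x ∂(volume.restrict (Ioi (0 : ℝ))),
        f x = g x + 2 / (Real.pi : ℂ) ^ 2 * (x : ℂ) *
            (∫ y in Ioi (0 : ℝ),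
              ((φ₁ y * (y / x) + φ₂ y * (x / y) : ℝ) : ℂ) *
                (1 / ((x : ℂ) ^ 2 - (y : ℂ) ^ 2)) * ((y / x : ℝ) : ℂ) ^ ((1 : ℂ)/2) *
                (Real.log (y / x) : ℂ) * g y) +
          (x : ℂ) ^ (-(1/2) : ℂ) * (A + B * (Real.log x : ℂ)))) := by
  have hpi : (Real.pi : ℂ) ≠ 0 := Complex.ofReal_ne_zero.2 Real.pi_ne_zero
  have hlam' : lam = (Real.pi : ℂ)⁻¹ := by rw [hlam, one_div]
  set f₀ : ℝ → ℂ := fun x => g x - ∫ y, ((dixonKernel x y : ℂ) * ((φ₁ y : ℂ) * g y) +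
      (dixonKernel y x : ℂ) * ((φ₂ y : ℂ) * g y)) ∂posVolume with hf₀
  obtain ⟨hE, heq⟩ := resolvent_memE_and_eq hφ hg (f := f₀) fun _ => rfl
  have hker : ∀ x : ℝ, 0 < x → EqOn (fun y : ℝ =>
      ((φ₁ y * (y / x) + φ₂ y * (x / y) : ℝ) : ℂ) *
        (1 / ((x : ℂ) ^ 2 - (y : ℂ) ^ 2)) * ((y / x : ℝ) : ℂ) ^ ((1 : ℂ)/2) *
        (Real.log (y / x) : ℂ) * g y) (fun y => ((-(Real.pi ^ 2 / (2 * x)) : ℝ) : ℂ) *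
        ((dixonKernel x y : ℂ) * ((φ₁ y : ℂ) * g y) +
          (dixonKernel y x : ℂ) * ((φ₂ y : ℂ) * g y))) (Ioi 0) :=
    fun x hx y hy => resolvent_integrand_eq hx hy _ _ _
  have hint : ∀ x : ℝ, 0 < x → IntegrableOn (fun y : ℝ =>
      ((φ₁ y * (y / x) + φ₂ y * (x / y) : ℝ) : ℂ) *
        (1 / ((x : ℂ) ^ 2 - (y : ℂ) ^ 2)) * ((y / x : ℝ) : ℂ) ^ ((1 : ℂ)/2) *
        (Real.log (y / x) : ℂ) * g y) (Ioi 0) := by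
    intro x hx
    obtain ⟨g₁, g₂, hg₁, hg₂, -, -, -, hsplit⟩ := hg.split hφ
    obtain ⟨-, -, -, a4, a5⟩ := hsplit x hx
    rw [integrableOn_congr_fun (hker x hx) measurableSet_Ioi]
    simp only [hg₁, hg₂] at a4 a5
    exact (a4.add a5).const_mul _
  have hval : ∀ x : ℝ, 0 < x → g x + 2 / (Real.pi : ℂ) ^ 2 * (x : ℂ) *
      (∫ y in Ioi (0 : ℝ),
        ((φ₁ y * (y / x) + φ₂ y * (x / y) : ℝ) : ℂ) *
          (1 / ((x : ℂ) ^ 2 - (y : ℂ) ^ 2)) * ((y / x : ℝ) : ℂ) ^ ((1 : ℂ)/2) *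
          (Real.log (y / x) : ℂ) * g y) = f₀ x := by
    intro x hx
    have hxc : (x : ℂ) ≠ 0 := Complex.ofReal_ne_zero.2 hx.ne'
    rw [setIntegral_congr_fun measurableSet_Ioi (hker x hx), integral_const_mul, hf₀]
    push_cast
    field_simp
    ring
  have hsub : ∀ x : ℝ, 0 < x →
      stieltjes (fun y => f y - f₀ y) x = stieltjes f x - stieltjes f₀ x := by
    intro x hx
    unfold stieltjes
    rw [← integral_sub (hf.integrable_div_add hx) (hE.integrable_div_add hx)]
    simp only [sub_div]
  constructor
  · rintro ⟨-, hS⟩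
    refine ⟨hint, ?_⟩
    have hd : MemE (fun y => f y - f₀ y) := by
      refine (hf.sub hE).congr (Filter.Eventually.of_forall fun y => ?_)
      simp only [Pi.sub_apply, sub_div]
    obtain ⟨A, B, hAB⟩ := exists_eq_of_eq_stieltjes hφ hd (by
      filter_upwards [ae_restrict_mem measurableSet_Ioi, hS] with x hx hxS
      change f x = g x + lam * stieltjes f x at hxS
      rw [hsub x hx, hxS, heq x hx, hlam']
      ring)
    refine ⟨A, B, ?_⟩
    filter_upwards [ae_restrict_mem measurableSet_Ioi, hAB] with x hx hxAB
    have hx : 0 < x := hx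
    rw [hval x hx, ofReal_cpow_neg_one_half hx.le, ← hxAB]
    ring
  · rintro ⟨-, A, B, hAB⟩
    refine ⟨fun x hx => hf.integrable_div_add hx, ?_⟩
    have hd : ∀ᵐ x ∂posVolume,
        f x - f₀ x = (((√x)⁻¹ : ℝ) : ℂ) * (A + B * (Real.log x : ℂ)) := by
      filter_upwards [ae_restrict_mem measurableSet_Ioi, hAB] with x hx hxAB
      have hx : 0 < x := hx
      rw [hxAB, hval x hx, ofReal_cpow_neg_one_half hx.le]
      ring
    filter_upwards [ae_restrict_mem measurableSet_Ioi, hd] with x hx hxd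
    have h1 : stieltjes (fun y => f y - f₀ y) x =
        stieltjes (fun y => (((√y)⁻¹ : ℝ) : ℂ) * (A + B * (Real.log y : ℂ))) x := by
      refine integral_congr_ae ?_
      filter_upwards [hd] with y hy
      rw [hy]
    rw [hsub x hx, (stieltjes_inv_sqrt_mul_log A B hx).2, ← hxd] at h1
    change f x = g x + lam * stieltjes f x
    have h2 : stieltjes f x = stieltjes f₀ x + Real.pi * (f x - f₀ x) := by
      linear_combination h1
    have h3 := heq x hx
    rw [h2, hlam', mul_add, inv_mul_cancel_left₀ hpi]
    linear_combination h3

end
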